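/- Let G = Θ(2,3,3,3,3,3,2,2). Then P_DP(G,3) = P(G,3), and there exists N ∈ ℕ such that P_DP(G,m) < P(G,m) for all m ≥ N. -/

import Mathlib

open Finset

/-- An `m`-fold cover `𝓗 = (L, H)` of `G`, represented (up to isomorphism) on the vertex set
`V × Fin m`, with `L v = {v} × Fin m`.  The fields record that each part `L v` induces a
clique in `H`, that cross-edges occur only over edges of `G`, and that the cross-edges
between two parts form a (possibly empty) matching. -/
structure DPCover {V : Type*} (G : SimpleGraph V) (m : ℕ) where
  H : SimpleGraph (V × Fin m)
  fiber_clique : ∀ (v : V) (a b : Fin m), a ≠ b → H.Adj (v, a) (v, b)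
  cross_only_edges : ∀ (u v : V) (a b : Fin m), u ≠ v → H.Adj (u, a) (v, b) → G.Adj u v
  cross_matching : ∀ (u v : V), u ≠ v → ∀ (a b b' : Fin m),
    H.Adj (u, a) (v, b) → H.Adj (u, a) (v, b') → b = b'

/-- A full `m`-fold cover: every matching between `L u` and `L v` for `uv ∈ E(G)` is perfect. -/
def DPCover.IsFull {V : Type*} {G : SimpleGraph V} {m : ℕ} (C : DPCover G m) : Prop :=
  ∀ (u v : V), G.Adj u v → ∀ a : Fin m, ∃ b : Fin m, C.H.Adj (u, a) (v, b)

/-- `P_DP(G, 𝓗)`: the number of `𝓗`-colorings of `G`, i.e. of independent sets in `H` of size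
`|V(G)|` (equivalently, of independent transversals of the parts `L v`). -/
noncomputable def DPCover.count {V : Type*} {G : SimpleGraph V} {m : ℕ} (C : DPCover G m) : ℕ :=
  Nat.card {c : V → Fin m // ∀ u v : V, u ≠ v → ¬ C.H.Adj (u, c u) (v, c v)}

/-- The DP color function `P_DP(G, m)`: the minimum of `P_DP(G, 𝓗)` over all
`m`-fold covers `𝓗` of `G`. -/
noncomputable def PDP {V : Type*} (G : SimpleGraph V) (m : ℕ) : ℕ :=
  sInf (Set.range fun C : DPCover G m => C.count)

/-- The dual DP color function `P*_DP(G, m)`: the maximum of `P_DP(G, 𝓗)` over all full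
`m`-fold covers `𝓗` of `G`. -/
noncomputable def PDPdual {V : Type*} (G : SimpleGraph V) (m : ℕ) : ℕ :=
  sSup {k : ℕ | ∃ C : DPCover G m, C.IsFull ∧ C.count = k}

/-- The chromatic polynomial `P(G, m)`: the number of proper colorings of `G` with colors
from `{1, …, m}`. -/
noncomputable def chromP {V : Type*} (G : SimpleGraph V) (m : ℕ) : ℕ :=
  Nat.card {c : V → Fin m // ∀ u v : V, G.Adj u v → c u ≠ c v}

/-- Vertices of the generalized theta graph `Θ(l 0, …, l (n-1))`: two end vertices
`u = Sum.inl false` and `w = Sum.inl true`, and internal vertices `(i, j)` with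
`j ∈ {0, …, l i - 2}` for the `i`-th path (listed along the path from `u` to `w`). -/
abbrev ThetaV {n : ℕ} (l : Fin n → ℕ) : Type :=
  Bool ⊕ (Σ i : Fin n, Fin (l i - 1))

/-- The relation generating the edges of the generalized theta graph. -/
def thetaRel {n : ℕ} (l : Fin n → ℕ) : ThetaV l → ThetaV l → Prop
  | Sum.inl _, Sum.inl _ => ∃ i, l i = 1
  | Sum.inl a, Sum.inr ⟨i, j⟩ => (a = false ∧ (j : ℕ) = 0) ∨ (a = true ∧ (j : ℕ) = l i - 2)
  | Sum.inr _, Sum.inl _ => False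
  | Sum.inr ⟨i, j⟩, Sum.inr ⟨i', j'⟩ => i = i' ∧ (j' : ℕ) = (j : ℕ) + 1

/-- The generalized theta graph `Θ(l 0, …, l (n-1))`: two end vertices `u` and `w` joined by
`n` internally disjoint paths, the `i`-th of length `l i`. -/
def thetaGraph {n : ℕ} (l : Fin n → ℕ) : SimpleGraph (ThetaV l) :=
  SimpleGraph.fromRel (thetaRel l)

/-- The end vertex `u`. -/
def thetaU {n : ℕ} (l : Fin n → ℕ) : ThetaV l := Sum.inl false

/-- The end vertex `w`. -/
def thetaW {n : ℕ} (l : Fin n → ℕ) : ThetaV l := Sum.inl true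

/-- Two relations with unique partners on a finite colour set extend to a permutation. -/
theorem exists_perm_of_matching {m : ℕ} (R : Fin m → Fin m → Prop)
    (hr : ∀ a b b', R a b → R a b' → b = b') (hl : ∀ a a' b, R a b → R a' b → a = a') :
    ∃ σ : Equiv.Perm (Fin m), ∀ a b, R a b → b = σ a := by
  classical
  let f : Fin m → Fin m := fun a => if h : ∃ b, R a b then h.choose else a
  have hf : ∀ a b, R a b → f a = b := by
    intro a b hab
    have h : ∃ b, R a b := ⟨b, hab⟩
    simp only [f, dif_pos h]
    exact hr _ _ _ h.choose_spec hab
  have hinj : Set.InjOn f (Finset.univ.filter fun a => ∃ b, R a b : Finset (Fin m)) := by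
    intro a ha a' ha' haa
    simp only [coe_filter, mem_univ, true_and, Set.mem_ofPred_eq] at ha ha'
    obtain ⟨b, hb⟩ := ha
    obtain ⟨b', hb'⟩ := ha'
    rw [hf _ _ hb, hf _ _ hb'] at haa
    subst haa
    exact hl _ _ _ hb hb'
  obtain ⟨g, hg⟩ := Finset.exists_equiv_extend_of_card_eq (t := Finset.univ)
    (by simp) (Finset.subset_univ _) hinj
  refine ⟨g.trans (Equiv.subtypeUnivEquiv fun x => Finset.mem_univ x), fun a b hab => ?_⟩
  have h := hg a (by simpa using ⟨b, hab⟩)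
  rw [hf _ _ hab] at h
  simpa using h.symm

theorem DPCover.exists_perm {V : Type*} {G : SimpleGraph V} {m : ℕ} (C : DPCover G m)
    {u v : V} (huv : u ≠ v) :
    ∃ σ : Equiv.Perm (Fin m), ∀ a b, C.H.Adj (u, a) (v, b) → b = σ a :=
  exists_perm_of_matching _ (fun a b b' => C.cross_matching u v huv a b b')
    (fun a a' b h h' => C.cross_matching v u huv.symm b a a' h.symm h'.symm)

/-- The full cover of `G` whose matchings are given by a compatible family of permutations. -/
def permCover {V : Type*} (G : SimpleGraph V) {m : ℕ} (σ : V → V → Equiv.Perm (Fin m))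
    (hσ : ∀ u v, σ v u = (σ u v)⁻¹) : DPCover G m where
  H :=
    { Adj := fun p q => (p.1 = q.1 ∧ p.2 ≠ q.2) ∨ (G.Adj p.1 q.1 ∧ q.2 = σ p.1 q.1 p.2)
      symm := ⟨by
        rintro ⟨u, a⟩ ⟨v, b⟩ (⟨h, h'⟩ | ⟨h, h'⟩)
        · exact Or.inl ⟨h.symm, h'.symm⟩
        · refine Or.inr ⟨h.symm, ?_⟩
          simp only at h' ⊢
          rw [hσ u v, h']
          simp⟩
      loopless := ⟨by rintro ⟨u, a⟩; simp⟩ }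
  fiber_clique := fun v a b hab => Or.inl ⟨rfl, hab⟩
  cross_only_edges := by
    rintro u v a b huv (⟨h, -⟩ | ⟨h, -⟩)
    · exact absurd h huv
    · exact h
  cross_matching := by
    rintro u v huv a b b' (⟨h, -⟩ | ⟨-, h⟩) (⟨h', -⟩ | ⟨-, h'⟩)
    · exact absurd h huv
    · exact absurd h huv
    · exact absurd h' huv
    · exact h.trans h'.symm

theorem permCover_adj {V : Type*} {G : SimpleGraph V} {m : ℕ} {σ : V → V → Equiv.Perm (Fin m)}
    {hσ : ∀ u v, σ v u = (σ u v)⁻¹} {u v : V} (huv : G.Adj u v) (a b : Fin m) :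
    (permCover G σ hσ).H.Adj (u, a) (v, b) ↔ b = σ u v a := by
  simp [permCover, huv, huv.ne]

theorem chromP_eq_count {V : Type*} (G : SimpleGraph V) (m : ℕ) :
    chromP G m = (permCover G (m := m) (fun _ _ => 1) (fun _ _ => by simp)).count := by
  unfold chromP DPCover.count
  refine Nat.card_congr (Equiv.subtypeEquivRight fun c => ?_)
  constructor
  · rintro h u v huv (⟨h', -⟩ | ⟨h', h''⟩)
    · exact huv h'
    · exact h u v h' (by simpa using h''.symm)
  · intro h u v huv hc
    exact h u v huv.ne ((permCover_adj huv _ _).2 (by simpa using hc.symm))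

theorem PDP_le_count {V : Type*} {G : SimpleGraph V} {m : ℕ} (C : DPCover G m) :
    PDP G m ≤ C.count :=
  Nat.sInf_le ⟨C, rfl⟩

section Theta

variable {n : ℕ} {l : Fin n → ℕ} {m : ℕ}

/-- `y` extends the colours `a`, `b` of the end vertices along the `i`-th path. -/
def PathColoring (C : DPCover (thetaGraph l) m) (i : Fin n) (a b : Fin m)
    (y : Fin (l i - 1) → Fin m) : Prop :=
  (∀ j, ¬ C.H.Adj (Sum.inl false, a) (Sum.inr ⟨i, j⟩, y j)) ∧
  (∀ j, ¬ C.H.Adj (Sum.inr ⟨i, j⟩, y j) (Sum.inl true, b)) ∧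
  ∀ j j', j ≠ j' → ¬ C.H.Adj (Sum.inr ⟨i, j⟩, y j) (Sum.inr ⟨i, j'⟩, y j')

/-- The number of extensions of the colours `a`, `b` of the end vertices to the `i`-th path. -/
noncomputable def pathCount (C : DPCover (thetaGraph l) m) (i : Fin n) (a b : Fin m) : ℕ :=
  Nat.card {y : Fin (l i - 1) → Fin m // PathColoring C i a b y}

theorem theta_independent_iff (hl : ∀ i, l i ≠ 1) (C : DPCover (thetaGraph l) m)
    (c : ThetaV l → Fin m) :
    (∀ u v, u ≠ v → ¬ C.H.Adj (u, c u) (v, c v)) ↔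
      ∀ i, PathColoring C i (c (Sum.inl false)) (c (Sum.inl true))
        fun j => c (Sum.inr ⟨i, j⟩) := by
  constructor
  · intro h i
    exact ⟨fun j => h _ _ (by simp), fun j => h _ _ (by simp),
      fun j j' hj => h _ _ (by simpa using hj)⟩
  · intro h
    have huw : ∀ e e', e ≠ e' → ¬ C.H.Adj (Sum.inl e, c (Sum.inl e)) (Sum.inl e', c (Sum.inl e')) := by
      intro e e' hee hadj
      have := C.cross_only_edges _ _ _ _ (by simpa using hee) hadj
      simp [thetaGraph, thetaRel, hl] at this
    have hux : ∀ e i j, ¬ C.H.Adj (Sum.inl e, c (Sum.inl e)) (Sum.inr ⟨i, j⟩, c (Sum.inr ⟨i, j⟩)) := by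
      intro e i j
      cases e
      · exact (h i).1 j
      · exact fun h' => (h i).2.1 j h'.symm
    rintro (e | ⟨i, j⟩) (e' | ⟨i', j'⟩) hne hadj
    · exact huw e e' (by simpa using hne) hadj
    · exact hux _ _ _ hadj
    · exact hux _ _ _ hadj.symm
    · have hi : i = i' := by
        have := C.cross_only_edges _ _ _ _ hne hadj
        simp only [thetaGraph, SimpleGraph.fromRel_adj, thetaRel] at this
        rcases this.2 with h' | h'
        · exact h'.1
        · exact h'.1.symm
      subst hi
      exact (h i).2.2 j j' (by simpa using hne) hadj

/-- Colourings of a theta graph are triples: colours of the two end vertices, together with an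
extension to each path. -/
def thetaColoringEquiv (hl : ∀ i, l i ≠ 1) (C : DPCover (thetaGraph l) m) :
    {c : ThetaV l → Fin m // ∀ u v, u ≠ v → ¬ C.H.Adj (u, c u) (v, c v)} ≃
      Σ a : Fin m, Σ b : Fin m, ∀ i, {y : Fin (l i - 1) → Fin m // PathColoring C i a b y} where
  toFun c := ⟨c.1 (Sum.inl false), c.1 (Sum.inl true), fun i =>
    ⟨fun j => c.1 (Sum.inr ⟨i, j⟩), (theta_independent_iff hl C c.1).1 c.2 i⟩⟩
  invFun t := ⟨Sum.elim (fun e => cond e t.2.1 t.1) fun x => (t.2.2 x.1).1 x.2,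
    (theta_independent_iff hl C _).2 fun i => (t.2.2 i).2⟩
  left_inv c := by
    ext (⟨_ | _⟩ | x) <;> rfl
  right_inv _ := rfl

theorem theta_count_eq (hl : ∀ i, l i ≠ 1) (C : DPCover (thetaGraph l) m) :
    C.count = ∑ a, ∑ b, ∏ i, pathCount C i a b := by
  unfold DPCover.count
  rw [Nat.card_congr (thetaColoringEquiv hl C), Nat.card_sigma]
  simp_rw [Nat.card_sigma, Nat.card_pi]
  rfl

theorem pathCount_of_length_two (C : DPCover (thetaGraph l) m) {i : Fin n} (hi : l i = 2)
    (a b : Fin m) :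
    pathCount C i a b = Nat.card {x : Fin m //
      ¬ C.H.Adj (Sum.inl false, a) (Sum.inr ⟨i, ⟨0, by lia⟩⟩, x) ∧
      ¬ C.H.Adj (Sum.inr ⟨i, ⟨0, by lia⟩⟩, x) (Sum.inl true, b)} := by
  have h0 : ∀ j : Fin (l i - 1), j = ⟨0, by lia⟩ := fun j => Fin.ext (by simp only; lia)
  refine Nat.card_congr
    { toFun := fun y => ⟨y.1 ⟨0, by lia⟩, y.2.1 _, y.2.2.1 _⟩
      invFun := fun x => ⟨fun _ => x.1, fun j => ?_, fun j => ?_, fun j j' hj => ?_⟩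
      left_inv := fun y => ?_
      right_inv := fun _ => rfl }
  · rw [h0 j]; exact x.2.1
  · rw [h0 j]; exact x.2.2
  · exact absurd ((h0 j).trans (h0 j').symm) hj
  · ext j
    simp only
    rw [h0 j]

theorem pathCount_of_length_three (C : DPCover (thetaGraph l) m) {i : Fin n} (hi : l i = 3)
    (a b : Fin m) :
    pathCount C i a b = Nat.card {p : Fin m × Fin m //
      ¬ C.H.Adj (Sum.inl false, a) (Sum.inr ⟨i, ⟨0, by lia⟩⟩, p.1) ∧
      ¬ C.H.Adj (Sum.inr ⟨i, ⟨0, by lia⟩⟩, p.1) (Sum.inr ⟨i, ⟨1, by lia⟩⟩, p.2) ∧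
      ¬ C.H.Adj (Sum.inr ⟨i, ⟨1, by lia⟩⟩, p.2) (Sum.inl true, b)} := by
  have h01 : ∀ j : Fin (l i - 1), j = ⟨0, by lia⟩ ∨ j = ⟨1, by lia⟩ := fun j => by
    simp only [Fin.ext_iff]; lia
  refine Nat.card_congr
    { toFun := fun y => ⟨(y.1 ⟨0, by lia⟩, y.1 ⟨1, by lia⟩), y.2.1 _, y.2.2.2 _ _ (by simp), y.2.2.1 _⟩
      invFun := fun p => ⟨fun j => if (j : ℕ) = 0 then p.1.1 else p.1.2,
        fun j => ?_, fun j => ?_, fun j j' hj => ?_⟩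
      left_inv := fun y => ?_
      right_inv := fun _ => rfl }
  · obtain rfl | rfl := h01 j
    · exact p.2.1
    · intro h
      have := C.cross_only_edges _ _ _ _ (by simp) h
      simp [thetaGraph, thetaRel] at this
  · obtain rfl | rfl := h01 j
    · intro h
      have := C.cross_only_edges _ _ _ _ (by simp) h
      simp [thetaGraph, thetaRel, hi] at this
    · exact p.2.2.2
  · obtain rfl | rfl := h01 j <;> obtain rfl | rfl := h01 j'
    · exact absurd rfl hj
    · exact p.2.2.1
    · exact fun h => p.2.2.1 h.symm
    · exact absurd rfl hj
  · ext j
    obtain rfl | rfl := h01 j <;> rfl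

theorem card_avoid_two (hm : 2 ≤ m) (x : Fin m) (τ : Equiv.Perm (Fin m)) (b : Fin m) :
    #{z : Fin m | z ≠ x ∧ b ≠ τ z} = m - 2 + if b = τ x then 1 else 0 := by
  have h : ({z : Fin m | z ≠ x ∧ b ≠ τ z} : Finset (Fin m)) = {x, τ.symm b}ᶜ := by
    ext z
    simp [Equiv.eq_symm_apply, eq_comm]
  rw [h, card_compl, Fintype.card_fin]
  split_ifs with hb
  · simp only [hb, Equiv.symm_apply_apply, pair_eq_singleton, card_singleton]
    lia
  · rw [card_pair]
    · rfl
    · rintro rfl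
      simp at hb

theorem card_avoid_three (hm : 2 ≤ m) (x : Fin m) (β τ : Equiv.Perm (Fin m)) (b : Fin m) :
    #{p : Fin m × Fin m | p.1 ≠ x ∧ p.2 ≠ β p.1 ∧ b ≠ τ p.2} =
      (m - 1) * (m - 2) + if b = τ (β x) then 0 else 1 := by
  have h : #{p : Fin m × Fin m | p.1 ≠ x ∧ p.2 ≠ β p.1 ∧ b ≠ τ p.2} =
      ∑ z ∈ ({x}ᶜ : Finset (Fin m)), #{y : Fin m | y ≠ β z ∧ b ≠ τ y} := by
    rw [← card_sigma]
    refine card_nbij' (fun p => ⟨p.1, p.2⟩) (fun p => (p.1, p.2)) ?_ ?_ ?_ ?_ <;>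
      simp +contextual [Set.MapsTo, Set.LeftInvOn]
  simp_rw [h, card_avoid_two hm]
  rw [sum_add_distrib, sum_const, card_compl, Fintype.card_fin, card_singleton, smul_eq_mul]
  congr 1
  have h' : ∀ z, b = τ (β z) ↔ z = β.symm (τ.symm b) := fun z => by
    rw [Equiv.eq_symm_apply, Equiv.eq_symm_apply, eq_comm]
  simp_rw [h', sum_ite_eq', mem_compl, mem_singleton, eq_comm (a := x)]
  split_ifs <;> simp_all

theorem pathCount_eq_of_length_two (hm : 2 ≤ m) (C : DPCover (thetaGraph l) m) {i : Fin n}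
    (hi : l i = 2) (α τ : Equiv.Perm (Fin m))
    (hα : ∀ a x, C.H.Adj (Sum.inl false, a) (Sum.inr ⟨i, ⟨0, by lia⟩⟩, x) ↔ x = α a)
    (hτ : ∀ x b, C.H.Adj (Sum.inr ⟨i, ⟨0, by lia⟩⟩, x) (Sum.inl true, b) ↔ b = τ x)
    (a b : Fin m) :
    pathCount C i a b = m - 2 + if b = τ (α a) then 1 else 0 := by
  rw [pathCount_of_length_two C hi, ← card_avoid_two hm]
  simp_rw [hα, hτ]
  rw [Nat.card_eq_fintype_card, Fintype.card_subtype]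

theorem pathCount_eq_of_length_three (hm : 2 ≤ m) (C : DPCover (thetaGraph l) m) {i : Fin n}
    (hi : l i = 3) (α β τ : Equiv.Perm (Fin m))
    (hα : ∀ a x, C.H.Adj (Sum.inl false, a) (Sum.inr ⟨i, ⟨0, by lia⟩⟩, x) ↔ x = α a)
    (hβ : ∀ x y, C.H.Adj (Sum.inr ⟨i, ⟨0, by lia⟩⟩, x) (Sum.inr ⟨i, ⟨1, by lia⟩⟩, y) ↔ y = β x)
    (hτ : ∀ y b, C.H.Adj (Sum.inr ⟨i, ⟨1, by lia⟩⟩, y) (Sum.inl true, b) ↔ b = τ y)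
    (a b : Fin m) :
    pathCount C i a b = (m - 1) * (m - 2) + if b = τ (β (α a)) then 0 else 1 := by
  rw [pathCount_of_length_three C hi, ← card_avoid_three hm]
  simp_rw [hα, hβ, hτ]
  rw [Nat.card_eq_fintype_card, Fintype.card_subtype]

theorem le_pathCount_of_length_two (hm : 2 ≤ m) (C : DPCover (thetaGraph l) m) {i : Fin n}
    (hi : l i = 2) (a : Fin m) :
    ∃ f, ∀ b, (m - 2 + if b = f then 1 else 0) ≤ pathCount C i a b := by
  obtain ⟨α, hα⟩ := C.exists_perm (u := Sum.inl false) (v := Sum.inr ⟨i, ⟨0, by lia⟩⟩) (by simp)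
  obtain ⟨τ, hτ⟩ := C.exists_perm (u := Sum.inr ⟨i, ⟨0, by lia⟩⟩) (v := Sum.inl true) (by simp)
  refine ⟨τ (α a), fun b => ?_⟩
  rw [pathCount_of_length_two C hi, ← card_avoid_two hm, ← Fintype.card_subtype,
    ← Nat.card_eq_fintype_card]
  exact Nat.card_le_card_of_injective
    (Subtype.map id fun x hx => ⟨fun h => hx.1 (hα _ _ h), fun h => hx.2 (hτ _ _ h)⟩)
    (Subtype.map_injective _ Function.injective_id)

theorem le_pathCount_of_length_three (hm : 2 ≤ m) (C : DPCover (thetaGraph l) m) {i : Fin n}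
    (hi : l i = 3) (a : Fin m) :
    ∃ f, ∀ b, ((m - 1) * (m - 2) + if b = f then 0 else 1) ≤ pathCount C i a b := by
  obtain ⟨α, hα⟩ := C.exists_perm (u := Sum.inl false) (v := Sum.inr ⟨i, ⟨0, by lia⟩⟩) (by simp)
  obtain ⟨β, hβ⟩ := C.exists_perm (u := Sum.inr ⟨i, ⟨0, by lia⟩⟩) (v := Sum.inr ⟨i, ⟨1, by lia⟩⟩)
    (by simp)
  obtain ⟨τ, hτ⟩ := C.exists_perm (u := Sum.inr ⟨i, ⟨1, by lia⟩⟩) (v := Sum.inl true) (by simp)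
  refine ⟨τ (β (α a)), fun b => ?_⟩
  rw [pathCount_of_length_three C hi, ← card_avoid_three hm, ← Fintype.card_subtype,
    ← Nat.card_eq_fintype_card]
  exact Nat.card_le_card_of_injective
    (Subtype.map id fun x hx =>
      ⟨fun h => hx.1 (hα _ _ h), fun h => hx.2.1 (hβ _ _ h), fun h => hx.2.2 (hτ _ _ h)⟩)
    (Subtype.map_injective _ Function.injective_id)

theorem theta_adj_first {i : Fin n} (h : 0 < l i - 1) :
    (thetaGraph l).Adj (Sum.inl false) (Sum.inr ⟨i, ⟨0, h⟩⟩) := by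
  simp [thetaGraph, thetaRel]

theorem theta_adj_last {i : Fin n} {k : ℕ} (hk : k = l i - 2) (h : k < l i - 1) :
    (thetaGraph l).Adj (Sum.inr ⟨i, ⟨k, h⟩⟩) (Sum.inl true) := by
  simp [thetaGraph, thetaRel, hk]

theorem theta_adj_succ {i : Fin n} {k : ℕ} (h : k < l i - 1) (h' : k + 1 < l i - 1) :
    (thetaGraph l).Adj (Sum.inr ⟨i, ⟨k, h⟩⟩) (Sum.inr ⟨i, ⟨k + 1, h'⟩⟩) := by
  simp [thetaGraph, thetaRel]

/-- The cover of a theta graph in which the matchings between `w` and its neighbours on the `i`-th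
path are given by the permutation `π i`, and all the other matchings are trivial. -/
def thetaTwist (l : Fin n → ℕ) (π : Fin n → Equiv.Perm (Fin m)) : DPCover (thetaGraph l) m :=
  permCover (thetaGraph l)
    (fun u v => match u, v with
      | Sum.inr x, Sum.inl true => π x.1
      | Sum.inl true, Sum.inr x => (π x.1)⁻¹
      | _, _ => 1)
    (by rintro (⟨_ | _⟩ | x) (⟨_ | _⟩ | y) <;> simp)

theorem pathCount_thetaTwist_two (hm : 2 ≤ m) (π : Fin n → Equiv.Perm (Fin m)) {i : Fin n}
    (hi : l i = 2) (a b : Fin m) :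
    pathCount (thetaTwist l π) i a b = m - 2 + if b = π i a then 1 else 0 :=
  pathCount_eq_of_length_two hm _ hi 1 (π i)
    (fun _ _ => permCover_adj (theta_adj_first _) _ _)
    (fun _ _ => permCover_adj (theta_adj_last (by lia) _) _ _) a b

theorem pathCount_thetaTwist_three (hm : 2 ≤ m) (π : Fin n → Equiv.Perm (Fin m)) {i : Fin n}
    (hi : l i = 3) (a b : Fin m) :
    pathCount (thetaTwist l π) i a b = (m - 1) * (m - 2) + if b = π i a then 0 else 1 :=
  pathCount_eq_of_length_three hm _ hi 1 1 (π i)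
    (fun _ _ => permCover_adj (theta_adj_first _) _ _)
    (fun _ _ => permCover_adj (theta_adj_succ _ _) _ _)
    (fun _ _ => permCover_adj (theta_adj_last (by lia) _) _ _) a b

theorem chromP_theta_eq_count (l : Fin n → ℕ) (m : ℕ) :
    chromP (thetaGraph l) m = (thetaTwist l fun _ => (1 : Equiv.Perm (Fin m))).count := by
  rw [chromP_eq_count, thetaTwist]
  congr
  funext u v
  rcases u with (⟨_ | _⟩ | x) <;> rcases v with (⟨_ | _⟩ | y) <;> simp

end Theta

/-- The path lengths are at least two. -/
theorem theta_lengths_ne_one (i : Fin 8) : (![2, 3, 3, 3, 3, 3, 2, 2] : Fin 8 → ℕ) i ≠ 1 := by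
  fin_cases i <;> simp

theorem count_thetaTwist {m : ℕ} (hm : 2 ≤ m) (s : Equiv.Perm (Fin m)) :
    (thetaTwist ![2, 3, 3, 3, 3, 3, 2, 2] (Function.update (fun _ => 1) 0 s)).count =
      ∑ a, ∑ b, (m - 2 + if b = s a then 1 else 0) * (m - 2 + if b = a then 1 else 0) ^ 2 *
        ((m - 1) * (m - 2) + if b = a then 0 else 1) ^ 5 := by
  rw [theta_count_eq theta_lengths_ne_one]
  refine sum_congr rfl fun a _ => sum_congr rfl fun b _ => ?_
  rw [Fin.prod_univ_eight]
  rw [pathCount_thetaTwist_two hm _ (i := 0) rfl, pathCount_thetaTwist_two hm _ (i := 6) rfl,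
    pathCount_thetaTwist_two hm _ (i := 7) rfl, pathCount_thetaTwist_three hm _ (i := 1) rfl,
    pathCount_thetaTwist_three hm _ (i := 2) rfl, pathCount_thetaTwist_three hm _ (i := 3) rfl,
    pathCount_thetaTwist_three hm _ (i := 4) rfl, pathCount_thetaTwist_three hm _ (i := 5) rfl]
  simp only [Function.update_self, Function.update_apply, Equiv.Perm.one_apply, reduceIte,
    Fin.reduceEq]
  ring

theorem chromP_theta_eq {m : ℕ} (hm : 2 ≤ m) :
    chromP (thetaGraph ![2, 3, 3, 3, 3, 3, 2, 2]) m =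
      ∑ a : Fin m, ∑ b : Fin m, (m - 2 + if b = a then 1 else 0) ^ 3 *
        ((m - 1) * (m - 2) + if b = a then 0 else 1) ^ 5 := by
  have h := count_thetaTwist hm 1
  rw [Function.update_eq_self_iff.2 rfl] at h
  rw [chromP_theta_eq_count, h]
  refine sum_congr rfl fun a _ => sum_congr rfl fun b _ => ?_
  rw [Equiv.Perm.one_apply]
  ring

theorem row_sum_bound (p q : Fin 3 → ℕ) (hp : ∑ b, p b = 3) (hq : ∑ b, q b = 5) :
    742 ≤ ∑ b, 2 ^ p b * (2 ^ q b * 3 ^ (5 - q b)) := by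
  rw [Fin.sum_univ_three] at *
  generalize p 0 = p0, p 1 = p1, p 2 = p2, q 0 = q0, q 1 = q1, q 2 = q2 at *
  have : p0 ≤ 3 := by lia
  have : p1 ≤ 3 := by lia
  have : q0 ≤ 5 := by lia
  have : q1 ≤ 5 := by lia
  obtain rfl : p2 = 3 - p0 - p1 := by lia
  obtain rfl : q2 = 5 - q0 - q1 := by lia
  interval_cases p0 <;> interval_cases p1 <;> try lia
  all_goals interval_cases q0 <;> interval_cases q1 <;> try lia

theorem row_sum_le (f : Fin 3 → Fin 3) (g : Fin 5 → Fin 3) :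
    742 ≤ ∑ b, (∏ i, (1 + if b = f i then 1 else 0)) * ∏ i, (2 + if b = g i then 0 else 1) := by
  have h1 : ∀ b, ∏ i, (1 + if b = f i then 1 else 0) = 2 ^ #{i | f i = b} := fun b => by
    rw [← prod_const, prod_filter]
    exact prod_congr rfl fun i _ => by split_ifs <;> simp_all
  have h2 : ∀ b, ∏ i, (2 + if b = g i then 0 else 1) =
      2 ^ #{i | g i = b} * 3 ^ (5 - #{i | g i = b}) := fun b => by
    have hc : 5 - #{i | g i = b} = #{i | ¬ g i = b} := by
      have := card_filter_add_card_filter_not (s := (univ : Finset (Fin 5))) (fun i => g i = b)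
      simp only [card_univ, Fintype.card_fin] at this
      lia
    rw [hc, ← prod_const, ← prod_const, ← prod_ite]
    exact prod_congr rfl fun i _ => by simp only [eq_comm (a := b)]; split_ifs <;> rfl
  simp_rw [h1, h2]
  refine row_sum_bound _ _ ?_ ?_
  · simpa using (card_eq_sum_card_fiberwise (s := univ) (f := f) (t := univ) (by simp)).symm
  · simpa using (card_eq_sum_card_fiberwise (s := univ) (f := g) (t := univ) (by simp)).symm

theorem theta_count_ge (C : DPCover (thetaGraph ![2, 3, 3, 3, 3, 3, 2, 2]) 3) :
    2226 ≤ C.count := by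
  rw [theta_count_eq theta_lengths_ne_one]
  have hrow : ∀ a, 742 ≤ ∑ b, ∏ i, pathCount C i a b := by
    intro a
    obtain ⟨f0, h0⟩ := le_pathCount_of_length_two le_add_self C (i := 0) rfl a
    obtain ⟨f1, h1⟩ := le_pathCount_of_length_three le_add_self C (i := 1) rfl a
    obtain ⟨f2, h2⟩ := le_pathCount_of_length_three le_add_self C (i := 2) rfl a
    obtain ⟨f3, h3⟩ := le_pathCount_of_length_three le_add_self C (i := 3) rfl a
    obtain ⟨f4, h4⟩ := le_pathCount_of_length_three le_add_self C (i := 4) rfl a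
    obtain ⟨f5, h5⟩ := le_pathCount_of_length_three le_add_self C (i := 5) rfl a
    obtain ⟨f6, h6⟩ := le_pathCount_of_length_two le_add_self C (i := 6) rfl a
    obtain ⟨f7, h7⟩ := le_pathCount_of_length_two le_add_self C (i := 7) rfl a
    refine (row_sum_le ![f0, f6, f7] ![f1, f2, f3, f4, f5]).trans (sum_le_sum fun b _ => ?_)
    rw [Fin.prod_univ_eight, Fin.prod_univ_three, Fin.prod_univ_five]
    calc _ = (1 + if b = f0 then 1 else 0) * (2 + if b = f1 then 0 else 1) *
          (2 + if b = f2 then 0 else 1) * (2 + if b = f3 then 0 else 1) *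
          (2 + if b = f4 then 0 else 1) * (2 + if b = f5 then 0 else 1) *
          (1 + if b = f6 then 1 else 0) * (1 + if b = f7 then 1 else 0) := by
            dsimp only [Matrix.cons_val]
            ac_rfl
      _ ≤ _ := by
        gcongr
        exacts [h0 b, h1 b, h2 b, h3 b, h4 b, h5 b, h6 b, h7 b]
  calc 2226 = ∑ _a : Fin 3, 742 := rfl
    _ ≤ _ := sum_le_sum fun a _ => hrow a

theorem twist_gain (k : ℕ) (hk : 2 ≤ k) :
    k ^ 2 * ((k + 1) * k + 1) ^ 5 < (k + 1) ^ 2 * ((k + 1) * k) ^ 5 := by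
  obtain ⟨j, rfl⟩ := Nat.exists_eq_add_of_le hk
  zify
  rw [← sub_pos]
  ring_nf
  positivity

theorem count_thetaTwist_lt {m : ℕ} (hm : 4 ≤ m) (s : Equiv.Perm (Fin m)) (hs : ∀ a, s a ≠ a) :
    (thetaTwist ![2, 3, 3, 3, 3, 3, 2, 2] (Function.update (fun _ => 1) 0 s)).count <
      chromP (thetaGraph ![2, 3, 3, 3, 3, 3, 2, 2]) m := by
  rw [count_thetaTwist (by lia), chromP_theta_eq (by lia)]
  obtain ⟨k, rfl⟩ := Nat.exists_eq_add_of_le' (show 2 ≤ m by lia)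
  simp only [Nat.add_sub_cancel, show k + 2 - 1 = k + 1 from rfl]
  refine sum_lt_sum_of_nonempty univ_nonempty fun a _ => ?_
  have hgain := twist_gain k (by lia)
  zify at hgain ⊢
  rw [← sub_pos, ← sum_sub_distrib]
  calc (0 : ℤ) < (k + 1) ^ 2 * ((k + 1) * k) ^ 5 - k ^ 2 * ((k + 1) * k + 1) ^ 5 := by
        linarith
    _ = ∑ b, ((if b = a then ((k : ℤ) + 1) ^ 2 * ((k + 1) * k) ^ 5 else 0) -
          if b = s a then (k : ℤ) ^ 2 * ((k + 1) * k + 1) ^ 5 else 0) := by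
        simp
    _ = _ := sum_congr rfl fun b _ => by
        by_cases hb : b = a
        · subst hb
          simp only [if_neg (hs b).symm, reduceIte]
          ring
        · by_cases hb' : b = s a
          · subst hb'
            simp only [if_neg hb, reduceIte]
            ring
          · simp only [if_neg hb, if_neg hb']
            ring

/-- Let `G = Θ(2,3,3,3,3,3,2,2)`.  Then `P_DP(G,3) = P(G,3)`, and there exists
`N ∈ ℕ` such that `P_DP(G,m) < P(G,m)` for all `m ≥ N`. -/
theorem statement4 :
    PDP (thetaGraph ![2, 3, 3, 3, 3, 3, 2, 2]) 3 =
      chromP (thetaGraph ![2, 3, 3, 3, 3, 3, 2, 2]) 3 ∧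
    ∃ N : ℕ, ∀ m : ℕ, N ≤ m →
      PDP (thetaGraph ![2, 3, 3, 3, 3, 3, 2, 2]) m <
        chromP (thetaGraph ![2, 3, 3, 3, 3, 3, 2, 2]) m := by
  refine ⟨le_antisymm ?_ ?_, 4, fun m hm => ?_⟩
  · rw [chromP_eq_count]
    exact PDP_le_count _
  · have h : chromP (thetaGraph ![2, 3, 3, 3, 3, 3, 2, 2]) 3 = 2226 := by
      rw [chromP_theta_eq (by lia)]
      decide
    rw [h]
    refine le_csInf ⟨_, permCover _ (fun _ _ => 1) (fun _ _ => by simp), rfl⟩ ?_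
    rintro _ ⟨C, rfl⟩
    exact theta_count_ge C
  · obtain ⟨k, rfl⟩ := Nat.exists_eq_add_of_le' (show 2 ≤ m by lia)
    exact (PDP_le_count _).trans_lt (count_thetaTwist_lt hm (finRotate (k + 2)) fun a => by
      rw [finRotate_apply]
      simp)
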